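/- arXiv:1005.1303 — 2 statements merged into one kernel-verified Lean document; each statement's English description precedes it below -/
import Mathlib

section
/- For all integers k, l ∈ ℤ and every constant n ∈ ℝ, the operators satisfy the Virasoro relation 𝕁^{(2)}_{k,n} ∘ 𝕁^{(2)}_{l,n} − 𝕁^{(2)}_{l,n} ∘ 𝕁^{(2)}_{k,n} = (k−l)·𝕁^{(2)}_{k+l,n} − ((k³−k)/6)·δ_{k,−l}·id as linear endomorphisms of R = ℝ[t_1, t_2, t_3, …]. -/
open MvPolynomial

/-- `∂/∂t_m` on `ℝ[t_1, t_2, …]`, with the convention that it is `0` for `m ≤ 0`. -/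
noncomputable def Dt (m : ℤ) : MvPolynomial ℕ+ ℝ → MvPolynomial ℕ+ ℝ :=
  if h : 0 < m then fun p => MvPolynomial.pderiv (⟨m.toNat, by omega⟩ : ℕ+) p else fun _ => 0

/-- Multiplication by `t_m` on `ℝ[t_1, t_2, …]`, with the convention `t_m = 0` for `m ≤ 0`. -/
noncomputable def Xt (m : ℤ) : MvPolynomial ℕ+ ℝ → MvPolynomial ℕ+ ℝ :=
  if h : 0 < m then
    fun p => (MvPolynomial.X (⟨m.toNat, by omega⟩ : ℕ+) : MvPolynomial ℕ+ ℝ) * p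
  else fun _ => 0

/-- `𝕁^{(2)}_{m,n} = (1/2)(Σ_{i+j=m} ∂²/∂t_i∂t_j + 2Σ_{i≥1} i t_i ∂/∂t_{i+m}
+ Σ_{i+j=−m} (i t_i)(j t_j)·) + (n+(m+1)/2)(∂/∂t_m + (−m)t_{−m}·) + (n(n+1)/2)δ_{m,0}`;
applied to a polynomial, all the sums have only finitely many nonzero terms. -/
noncomputable def J2 (m : ℤ) (n : ℝ) (p : MvPolynomial ℕ+ ℝ) : MvPolynomial ℕ+ ℝ :=
  (1 / 2 : ℝ) • ((∑ i ∈ Finset.Icc (1 : ℤ) (m - 1), Dt i (Dt (m - i) p))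
      + (2 : ℝ) • (∑ᶠ i : ℕ+, ((i : ℕ) : ℝ) •
          ((MvPolynomial.X i : MvPolynomial ℕ+ ℝ) * Dt (((i : ℕ) : ℤ) + m) p))
      + (∑ i ∈ Finset.Icc (1 : ℤ) (-m - 1), ((i : ℝ) * ((-m - i : ℤ) : ℝ)) • Xt i (Xt (-m - i) p)))
    + (n + ((m : ℝ) + 1) / 2) • (Dt m p + ((-m : ℤ) : ℝ) • Xt (-m) p)
    + (if m = 0 then n * (n + 1) / 2 else 0) • p

namespace Virasoro

local notation "𝓡" => MvPolynomial ℕ+ ℝ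

/-- The derivation `∂/∂t_m`, zero for `m ≤ 0`. -/
noncomputable def partialD (m : ℤ) : Derivation ℝ 𝓡 𝓡 :=
  if 0 < m then pderiv m.toNat.toPNat' else 0

/-- The variable `t_m`, zero for `m ≤ 0`. -/
noncomputable def var (m : ℤ) : 𝓡 :=
  if 0 < m then X m.toNat.toPNat' else 0

lemma mk_toNat_eq_toPNat' {m : ℤ} (h : 0 < m) :
    (⟨m.toNat, by omega⟩ : ℕ+) = m.toNat.toPNat' :=
  PNat.coe_injective <| by
    rw [PNat.mk_coe, Nat.toPNat'_coe, if_pos (by omega)]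

lemma Dt_eq (m : ℤ) (p : 𝓡) : Dt m p = partialD m p := by
  by_cases h : 0 < m
  · rw [partialD, if_pos h, ← mk_toNat_eq_toPNat' h]
    exact congrFun (dif_pos h) p
  · rw [partialD, if_neg h, Derivation.zero_apply]
    exact congrFun (dif_neg h) p

lemma Xt_eq (m : ℤ) (p : 𝓡) : Xt m p = var m * p := by
  by_cases h : 0 < m
  · rw [Xt, var, dif_pos h, if_pos h, mk_toNat_eq_toPNat' h]
  · rw [Xt, var, dif_neg h, if_neg h, zero_mul]

lemma var_coe (i : ℕ+) : var ((i : ℕ) : ℤ) = X i := by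
  have h : (0 : ℤ) < ((i : ℕ) : ℤ) := by exact_mod_cast i.pos
  rw [var, if_pos h, Int.toNat_natCast, PNat.coe_toPNat']

lemma partialD_coe (i : ℕ+) : partialD ((i : ℕ) : ℤ) = pderiv i := by
  have h : (0 : ℤ) < ((i : ℕ) : ℤ) := by exact_mod_cast i.pos
  rw [partialD, if_pos h, Int.toNat_natCast, PNat.coe_toPNat']

lemma var_of_nonpos {m : ℤ} (h : m ≤ 0) : var m = 0 := if_neg (by omega)

lemma partialD_of_nonpos {m : ℤ} (h : m ≤ 0) : partialD m = 0 := if_neg (by omega)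

lemma exists_pnat_coe_eq {m : ℤ} (h : 0 < m) : ∃ i : ℕ+, ((i : ℕ) : ℤ) = m :=
  ⟨⟨m.toNat, by omega⟩, by simp; omega⟩

lemma partialD_var (i j : ℤ) : partialD i (var j) = if i = j ∧ 0 < i then 1 else 0 := by
  rcases le_or_gt i 0 with hi | hi
  · rw [partialD_of_nonpos hi, if_neg (by omega)]; rfl
  rcases le_or_gt j 0 with hj | hj
  · rw [var_of_nonpos hj, if_neg (by omega), map_zero]
  obtain ⟨i, rfl⟩ := exists_pnat_coe_eq hi
  obtain ⟨j, rfl⟩ := exists_pnat_coe_eq hj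
  rw [partialD_coe, var_coe, pderiv_X]
  by_cases h : j = i
  · subst h; simp
  · have h' : i ≠ j := fun e => h e.symm
    simp [h, h']

lemma lie_derivation_eq {D E F : Derivation ℝ 𝓡 𝓡}
    (h : ∀ i, 0 < i → D (E (var i)) - E (D (var i)) = F (var i)) (p : 𝓡) :
    D (E p) - E (D p) = F p := by
  have : ⁅D, E⁆ = F := derivation_ext fun i => by
    rw [Derivation.commutator_apply, ← var_coe]
    exact h _ (by exact_mod_cast i.pos)
  rw [← this, Derivation.commutator_apply]

lemma partialD_comm (i j : ℤ) (p : 𝓡) : partialD i (partialD j p) = partialD j (partialD i p) := by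
  rw [← sub_eq_zero]
  refine lie_derivation_eq (F := 0) (fun m _ => ?_) p
  simp only [partialD_var]
  split_ifs <;> simp

/-- The oscillator `∂/∂t_m + (-m) t_{-m}`. -/
noncomputable def mode (m : ℤ) : Module.End ℝ 𝓡 :=
  (partialD m : 𝓡 →ₗ[ℝ] 𝓡) + (-m : ℝ) • LinearMap.mulLeft ℝ (var (-m))

lemma mode_apply (m : ℤ) (p : 𝓡) : mode m p = partialD m p + (-m : ℝ) • (var (-m) * p) := rfl

lemma mode_of_nonneg {m : ℤ} (h : 0 ≤ m) (p : 𝓡) : mode m p = partialD m p := by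
  rw [mode_apply, var_of_nonpos (by omega)]; simp

lemma mode_of_nonpos {m : ℤ} (h : m ≤ 0) (p : 𝓡) : mode m p = (-m : ℝ) • (var (-m) * p) := by
  rw [mode_apply, partialD_of_nonpos h]; simp

lemma mode_mul_sub_mul (k l : ℤ) :
    mode k * mode l - mode l * mode k = (if k + l = 0 then (k : ℝ) else 0) • 1 := by
  refine LinearMap.ext fun p => ?_
  simp only [LinearMap.sub_apply, Module.End.mul_apply, LinearMap.smul_apply, Module.End.one_apply]
  rcases le_total 0 k with hk | hk <;> rcases le_total 0 l with hl | hl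
  · simp only [mode_of_nonneg hk, mode_of_nonneg hl]
    rw [partialD_comm, sub_self]
    split_ifs with h
    · obtain rfl : k = 0 := by omega
      simp
    · simp
  · simp only [mode_of_nonneg hk, mode_of_nonpos hl, Derivation.map_smul, Derivation.leibniz,
      partialD_var, smul_eq_mul]
    rcases hk.eq_or_lt with rfl | hk
    · simp [partialD_of_nonpos]
    by_cases h : k + l = 0
    · obtain rfl : l = -k := by omega
      simp [hk]
    · have h' : ¬ k = -l := by omega
      simp [h, h']
  · simp only [mode_of_nonneg hl, mode_of_nonpos hk, Derivation.map_smul, Derivation.leibniz,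
      partialD_var, smul_eq_mul]
    rcases hl.eq_or_lt with rfl | hl
    · rcases eq_or_ne k 0 with rfl | h <;> simp [partialD_of_nonpos, *]
    by_cases h : k + l = 0
    · obtain rfl : l = -k := by omega
      have : k < 0 := by omega
      simp [this, smul_add]
    · have h' : ¬ l = -k := by omega
      simp [h, h']
  · simp only [mode_of_nonpos hk, mode_of_nonpos hl]
    rw [mul_smul_comm, mul_smul_comm, smul_comm, mul_left_comm, sub_self]
    split_ifs with h
    · obtain rfl : k = 0 := by omega
      simp
    · simp

lemma finite_partialD_ne_zero (m : ℤ) (p : 𝓡) :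
    {i : ℕ+ | partialD (((i : ℕ) : ℤ) + m) p ≠ 0}.Finite := by
  have hinj : Function.Injective fun i : ℕ+ => ((i : ℕ) : ℤ) + m := by
    intro i j h
    simpa using h
  refine ((p.vars.finite_toSet.image fun j : ℕ+ => ((j : ℕ) : ℤ)).preimage hinj.injOn).subset fun i hi => ?_
  rcases le_or_gt (((i : ℕ) : ℤ) + m) 0 with h | h
  · exact absurd (by rw [partialD_of_nonpos h]; rfl) hi
  obtain ⟨j, hj⟩ := exists_pnat_coe_eq h
  refine ⟨j, ?_, hj⟩
  by_contra hv
  refine hi ?_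
  rw [← hj, partialD_coe]
  exact pderiv_eq_zero_of_notMem_vars hv

lemma finite_support_cross (m : ℤ) (p : 𝓡) :
    (Function.support fun i : ℕ+ =>
      ((i : ℕ) : ℝ) • ((X i : 𝓡) * partialD (((i : ℕ) : ℤ) + m) p)).Finite := by
  refine (finite_partialD_ne_zero m p).subset fun i hi h => hi ?_
  simp [h]

/-- The derivation `Σ_{i ≥ 1} i t_i ∂/∂t_{i+m}`. -/
noncomputable def cross (m : ℤ) : Derivation ℝ 𝓡 𝓡 :=
  Derivation.mk'
    { toFun := fun p => ∑ᶠ i : ℕ+, ((i : ℕ) : ℝ) • ((X i : 𝓡) * partialD (((i : ℕ) : ℤ) + m) p)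
      map_add' := fun p q => by
        rw [← finsum_add_distrib (finite_support_cross m p) (finite_support_cross m q)]
        simp only [map_add, mul_add, smul_add]
      map_smul' := fun c p => by
        rw [RingHom.id_apply, smul_finsum' _ (finite_support_cross m p)]
        refine finsum_congr fun i => ?_
        rw [Derivation.map_smul, mul_smul_comm, smul_comm] }
    fun p q => by
      simp only [LinearMap.coe_mk, AddHom.coe_mk]
      rw [smul_finsum' p (finite_support_cross m q), smul_finsum' q (finite_support_cross m p),
        ← finsum_add_distrib]
      · refine finsum_congr fun i => ?_
        simp only [Derivation.leibniz, smul_eq_mul, mul_add, smul_add, mul_smul_comm, mul_left_comm]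
      · exact (finite_support_cross m q).subset fun i hi h => hi (by simp [h])
      · exact (finite_support_cross m p).subset fun i hi h => hi (by simp [h])

lemma cross_apply (m : ℤ) (p : 𝓡) :
    cross m p = ∑ᶠ i : ℕ+, ((i : ℕ) : ℝ) • ((X i : 𝓡) * partialD (((i : ℕ) : ℤ) + m) p) := rfl

lemma cross_var (m : ℤ) {j : ℤ} (hj : 0 < j) :
    cross m (var j) = ((j : ℝ) - m) • var (j - m) := by
  rw [cross_apply]
  rcases le_or_gt (j - m) 0 with h | h
  · rw [var_of_nonpos h, smul_zero]
    refine finsum_eq_zero_of_forall_eq_zero fun i => ?_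
    have := i.pos
    rw [partialD_var, if_neg (by omega)]
    simp
  · obtain ⟨i, hi⟩ := exists_pnat_coe_eq h
    rw [finsum_eq_single _ i]
    · rw [partialD_var, if_pos (by omega), ← hi, var_coe, mul_one]
      congr 1
      have : ((i : ℕ) : ℤ) = ((j - m : ℤ)) := hi
      exact_mod_cast this
    · intro i' hne
      rw [partialD_var, if_neg]
      · simp
      · rintro ⟨h1, -⟩
        refine hne (PNat.coe_injective ?_)
        omega

/-- The quadratic part of `J2`. -/
noncomputable def quad (m : ℤ) : Module.End ℝ 𝓡 :=
  (1 / 2 : ℝ) • ((∑ i ∈ Finset.Icc (1 : ℤ) (m - 1), mode i * mode (m - i))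
      + (2 : ℝ) • (cross m : 𝓡 →ₗ[ℝ] 𝓡)
      + ∑ i ∈ Finset.Icc (m + 1) (-1 : ℤ), mode i * mode (m - i))

lemma J2_eq (m : ℤ) (n : ℝ) (p : 𝓡) :
    J2 m n p = (quad m + (n + ((m : ℝ) + 1) / 2) • mode m
      + (if m = 0 then n * (n + 1) / 2 else 0 : ℝ) • 1 : Module.End ℝ 𝓡) p := by
  simp only [J2, quad, LinearMap.add_apply, LinearMap.smul_apply, LinearMap.sum_apply,
    Module.End.mul_apply, Module.End.one_apply, Derivation.coeFn_coe, cross_apply, mode_apply m,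
    Dt_eq, Xt_eq]
  have h1 : ∑ i ∈ Finset.Icc (1 : ℤ) (m - 1), partialD i (partialD (m - i) p) =
      ∑ i ∈ Finset.Icc (1 : ℤ) (m - 1), mode i (mode (m - i) p) := by
    refine Finset.sum_congr rfl fun i hi => ?_
    rw [Finset.mem_Icc] at hi
    rw [mode_of_nonneg (by omega), mode_of_nonneg (by omega)]
  have h2 : ∑ i ∈ Finset.Icc (1 : ℤ) (-m - 1),
      ((i : ℝ) * ((-m - i : ℤ) : ℝ)) • (var i * (var (-m - i) * p)) =
      ∑ i ∈ Finset.Icc (m + 1) (-1 : ℤ), mode i (mode (m - i) p) := by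
    refine Finset.sum_nbij' (fun i => -i) (fun i => -i) ?_ ?_ ?_ ?_ fun i hi => ?_
    · intro i hi; rw [Finset.mem_Icc] at hi ⊢; omega
    · intro i hi; rw [Finset.mem_Icc] at hi ⊢; omega
    · intro i _; exact neg_neg i
    · intro i _; exact neg_neg i
    rw [Finset.mem_Icc] at hi
    rw [mode_of_nonpos (by omega), mode_of_nonpos (by omega), mul_smul_comm, smul_smul, neg_neg,
      show -(m - -i) = -m - i by ring]
    push_cast
    congr 1
    ring
  rw [h1, h2, Int.cast_neg]

lemma sum_mode_lie (m l a b : ℤ)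
    (hab : ∀ i, i ∈ Finset.Icc a b ↔ m - i ∈ Finset.Icc a b) :
    (∑ i ∈ Finset.Icc a b, mode i * mode (m - i)) * mode l
      - mode l * (∑ i ∈ Finset.Icc a b, mode i * mode (m - i))
      = (if -l ∈ Finset.Icc a b then -2 * (l : ℝ) else 0) • mode (m + l) := by
  have key (i : ℤ) : mode i * mode (m - i) * mode l - mode l * (mode i * mode (m - i)) =
      (if i = -l then -(l : ℝ) else 0) • mode (m + l)
        + (if i = m + l then -(l : ℝ) else 0) • mode (m + l) := by
    have h1 : mode i * mode (m - i) * mode l - mode l * (mode i * mode (m - i)) =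
        mode i * (mode (m - i) * mode l - mode l * mode (m - i))
          + (mode i * mode l - mode l * mode i) * mode (m - i) := by 
      simp only [mul_sub, sub_mul, mul_assoc]; abel
    rw [h1, mode_mul_sub_mul, mode_mul_sub_mul, add_comm]
    congr 1
    · by_cases h : i = -l
      · subst h
        rw [if_pos (by omega), if_pos rfl, smul_mul_assoc, one_mul, sub_neg_eq_add, Int.cast_neg]
      · rw [if_neg (by omega), if_neg h]; simp
    · by_cases h : i = m + l
      · subst h
        rw [if_pos (by omega), if_pos rfl, mul_smul_comm, mul_one]
        push_cast
        congr 1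
        ring
      · rw [if_neg (by omega), if_neg h]; simp
  rw [Finset.sum_mul, Finset.mul_sum, ← Finset.sum_sub_distrib]
  simp only [key]
  rw [Finset.sum_add_distrib, ← Finset.sum_smul, ← Finset.sum_smul, Finset.sum_ite_eq',
    Finset.sum_ite_eq', ← add_smul]
  have h2 := hab (-l)
  rw [sub_neg_eq_add] at h2
  by_cases h : -l ∈ Finset.Icc a b
  · rw [if_pos h, if_pos (h2.1 h), if_pos h]; ring_nf
  · rw [if_neg h, if_neg (mt h2.2 h), if_neg h]; ring_nf

lemma quad_mul_mode_sub (m l : ℤ) :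
    quad m * mode l - mode l * quad m = -(l : ℝ) • mode (m + l) := by
  have hA := sum_mode_lie m l 1 (m - 1) fun i => by rw [Finset.mem_Icc, Finset.mem_Icc]; omega
  have hB := sum_mode_lie m l (m + 1) (-1) fun i => by rw [Finset.mem_Icc, Finset.mem_Icc]; omega
  have hD : (cross m : Module.End ℝ 𝓡) * mode l - mode l * (cross m : Module.End ℝ 𝓡) =
      (if -l ∈ Finset.Icc 1 (m - 1) ∨ -l ∈ Finset.Icc (m + 1) (-1) then 0 else -(l : ℝ))
        • mode (m + l) := by
    refine LinearMap.ext fun p => ?_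
    simp only [LinearMap.sub_apply, Module.End.mul_apply, LinearMap.smul_apply,
      Derivation.coeFn_coe, Finset.mem_Icc]
    rcases lt_trichotomy l 0 with hl | rfl | hl
    · rw [mode_of_nonpos hl.le, mode_of_nonpos hl.le, Derivation.map_smul, Derivation.leibniz,
        cross_var m (by omega : 0 < -l)]
      split_ifs with h
      · rw [var_of_nonpos (by omega : -l - m ≤ 0)]
        simp
      · rw [mode_of_nonpos (by omega), show -(m + l) = -l - m by ring]
        rw [smul_eq_mul, smul_eq_mul, smul_add, add_sub_cancel_left, mul_smul_comm, mul_comm p]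
        push_cast
        module
    · simp [mode_apply, partialD_of_nonpos, var_of_nonpos]
    · rw [mode_of_nonneg hl.le, mode_of_nonneg hl.le]
      have key := lie_derivation_eq (D := cross m) (E := partialD l)
        (F := -(l : ℝ) • partialD (m + l)) (fun i hi => ?_) p
      · rw [key, Derivation.smul_apply]
        split_ifs with h
        · rw [partialD_of_nonpos (by omega)]
          simp
        · rcases le_or_gt 0 (m + l) with h' | h'
          · rw [mode_of_nonneg h']
          · omega
      · rw [cross_var m hi, Derivation.map_smul, Derivation.smul_apply, partialD_var, partialD_var,
          partialD_var]
        have h0 : cross m (if l = i ∧ 0 < l then 1 else 0) = 0 := by split_ifs <;> simp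
        rw [h0, zero_sub, neg_smul]
        congr 1
        by_cases h : i = m + l
        · subst h
          rw [if_pos (by omega), if_pos (by omega)]
          push_cast
          congr 1
          ring
        · rw [if_neg (by omega), if_neg (by omega), smul_zero, smul_zero]
  have hsplit : quad m * mode l - mode l * quad m = (1 / 2 : ℝ) •
      (((∑ i ∈ Finset.Icc (1 : ℤ) (m - 1), mode i * mode (m - i)) * mode l
        - mode l * ∑ i ∈ Finset.Icc (1 : ℤ) (m - 1), mode i * mode (m - i))
      + (2 : ℝ) • ((cross m : Module.End ℝ 𝓡) * mode l - mode l * (cross m : Module.End ℝ 𝓡))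
      + ((∑ i ∈ Finset.Icc (m + 1) (-1 : ℤ), mode i * mode (m - i)) * mode l
        - mode l * ∑ i ∈ Finset.Icc (m + 1) (-1 : ℤ), mode i * mode (m - i))) := by
    rw [quad]
    simp only [smul_mul_assoc, mul_smul_comm, add_mul, mul_add, smul_add, smul_sub]
    abel
  rw [hsplit, hA, hB, hD, smul_smul, ← add_smul, ← add_smul, smul_smul]
  congr 1
  simp only [Finset.mem_Icc]
  split_ifs <;> first | omega | ring

/-- A linear endomorphism commuting with all oscillators is a scalar. -/
lemma eq_smul_one_of_commute (T : Module.End ℝ 𝓡) (h : ∀ l, T * mode l = mode l * T) :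
    T = constantCoeff (T 1) • 1 := by
  have hX (i : ℕ+) (p : 𝓡) : T (X i * p) = X i * T p := by
    have hi : (0 : ℤ) < ((i : ℕ) : ℤ) := by exact_mod_cast i.pos
    have h1 := LinearMap.congr_fun (h (-((i : ℕ) : ℤ))) p
    simp only [Module.End.mul_apply] at h1
    rw [mode_of_nonpos (by omega), mode_of_nonpos (by omega), map_smul, neg_neg, var_coe] at h1
    exact smul_right_injective 𝓡 (by simp) h1
  have hD (i : ℕ+) (p : 𝓡) : T (pderiv i p) = pderiv i (T p) := by
    have h1 := LinearMap.congr_fun (h ((i : ℕ) : ℤ)) p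
    simp only [Module.End.mul_apply] at h1
    rwa [mode_of_nonneg (by omega), mode_of_nonneg (by omega), partialD_coe] at h1
  have hT1 : T 1 = C (constantCoeff (T 1)) := by
    ext s
    rw [coeff_C]
    split_ifs with hs
    · rw [← hs]; rfl
    · obtain ⟨i, hi⟩ : ∃ i, s i ≠ 0 := by
        by_contra! hc
        exact hs (Finsupp.ext fun i => (hc i).symm)
      have h1 : coeff (s - Finsupp.single i 1) (pderiv i (T 1)) = 0 := by
        rw [← hD, pderiv_one, map_zero, coeff_zero]
      rw [coeff_pderiv, tsub_add_cancel_of_le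
        (Finsupp.single_le_iff.2 (Nat.one_le_iff_ne_zero.2 hi))] at h1
      refine (mul_eq_zero.1 h1).resolve_right ?_
      positivity
  refine LinearMap.ext fun p => ?_
  rw [LinearMap.smul_apply, Module.End.one_apply]
  induction p using MvPolynomial.induction_on with
  | C a =>
    rw [← mul_one (C a), ← smul_eq_C_mul, map_smul, hT1, constantCoeff_C, smul_comm,
      smul_eq_C_mul (1 : 𝓡), mul_one]
  | add p q hp hq => rw [map_add, hp, hq, smul_add]
  | mul_X p i hp => rw [mul_comm, hX, hp, mul_smul_comm]

lemma constantCoeff_mode_of_nonpos {m : ℤ} (h : m ≤ 0) (p : 𝓡) :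
    constantCoeff (mode m p) = 0 := by
  rw [mode_of_nonpos h, smul_eq_C_mul, map_mul, map_mul]
  have : constantCoeff (var (-m)) = 0 := by
    rw [var]
    split_ifs <;> simp
  rw [this]
  simp

lemma mode_one_of_nonneg {m : ℤ} (h : 0 ≤ m) : mode m 1 = 0 := by
  rw [mode_of_nonneg h, Derivation.map_one_eq_zero]

lemma quad_one (m : ℤ) :
    quad m 1 = (1 / 2 : ℝ) • ∑ i ∈ Finset.Icc (m + 1) (-1 : ℤ), mode i (mode (m - i) 1) := by
  have : ∑ i ∈ Finset.Icc (1 : ℤ) (m - 1), mode i (mode (m - i) 1) = 0 :=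
    Finset.sum_eq_zero fun i hi => by
      rw [Finset.mem_Icc] at hi
      rw [mode_one_of_nonneg (by omega), map_zero]
  simp only [quad, LinearMap.smul_apply, LinearMap.add_apply, LinearMap.sum_apply,
    Module.End.mul_apply, this, Derivation.coeFn_coe, Derivation.map_one_eq_zero, smul_zero,
    zero_add]

lemma constantCoeff_real_smul (c : ℝ) (p : 𝓡) : constantCoeff (c • p) = c * constantCoeff p := by
  rw [smul_eq_C_mul, map_mul, constantCoeff_C]

lemma constantCoeff_quad_one (m : ℤ) : constantCoeff (quad m 1) = 0 := by
  rw [quad_one, constantCoeff_real_smul, map_sum, Finset.sum_eq_zero, mul_zero]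
  intro i hi
  rw [Finset.mem_Icc] at hi
  exact constantCoeff_mode_of_nonpos (by omega) _

lemma quad_mode (m l : ℤ) (p : 𝓡) :
    quad m (mode l p) = mode l (quad m p) - (l : ℝ) • mode (m + l) p := by
  have h := LinearMap.congr_fun (quad_mul_mode_sub m l) p
  simp only [LinearMap.sub_apply, Module.End.mul_apply, LinearMap.smul_apply] at h
  rw [sub_eq_iff_eq_add] at h
  rw [h, neg_smul]
  abel

lemma constantCoeff_mode_mode_one (k : ℤ) {l : ℤ} (hl : l ≤ 0) :
    constantCoeff (mode k (mode l 1)) = if k + l = 0 then (k : ℝ) else 0 := by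
  have h := LinearMap.congr_fun (mode_mul_sub_mul k l) 1
  simp only [LinearMap.sub_apply, Module.End.mul_apply, LinearMap.smul_apply,
    Module.End.one_apply] at h
  rw [sub_eq_iff_eq_add] at h
  rw [h, map_add, constantCoeff_mode_of_nonpos hl, constantCoeff_real_smul, map_one, mul_one, add_zero]

lemma constantCoeff_quad_quad_one (k l : ℤ) :
    constantCoeff (quad k (quad l 1)) =
      if k + l = 0 then (1 / 2 : ℝ) * ∑ i ∈ Finset.Icc (l + 1) (-1 : ℤ), -(i : ℝ) * (k + i)
      else 0 := by
  rw [quad_one, map_smul, map_sum, constantCoeff_real_smul, map_sum]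
  have hterm : ∀ i ∈ Finset.Icc (l + 1) (-1 : ℤ),
      constantCoeff (quad k (mode i (mode (l - i) 1))) =
        if k + l = 0 then -(i : ℝ) * (k + i) else 0 := by
    intro i hi
    rw [Finset.mem_Icc] at hi
    rw [quad_mode, map_sub, constantCoeff_mode_of_nonpos (by omega), constantCoeff_real_smul,
      constantCoeff_mode_mode_one _ (by omega), show k + i + (l - i) = k + l by ring]
    split_ifs
    · push_cast; ring
    · ring
  rw [Finset.sum_congr rfl hterm]
  split_ifs
  · rfl
  · simp

lemma sum_neg_mul_add (k : ℕ) :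
    ∑ i ∈ Finset.Icc (-(k : ℤ) + 1) (-1 : ℤ), -(i : ℝ) * ((k : ℝ) + i) =
      ((k : ℝ) ^ 3 - k) / 6 := by
  have h1 : ∑ i ∈ Finset.Icc (-(k : ℤ) + 1) (-1 : ℤ), -(i : ℝ) * ((k : ℝ) + i) =
      ∑ j ∈ Finset.range k, (j : ℝ) * ((k : ℝ) - j) := by
    symm
    rw [← Finset.sum_subset (s₁ := (Finset.range k).filter (0 < ·)) (Finset.filter_subset _ _)]
    · refine Finset.sum_nbij' (fun j => -(j : ℤ)) (fun i => (-i).toNat) ?_ ?_ ?_ ?_ ?_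
      · intro j hj
        rw [Finset.mem_filter, Finset.mem_range] at hj
        rw [Finset.mem_Icc]; omega
      · intro i hi
        rw [Finset.mem_Icc] at hi
        rw [Finset.mem_filter, Finset.mem_range]; omega
      · intro j _; simp
      · intro i hi
        rw [Finset.mem_Icc] at hi
        omega
      · intro j _; push_cast; ring
    · intro j hj hj'
      have : j = 0 := by
        by_contra h
        exact hj' (Finset.mem_filter.2 ⟨hj, by omega⟩)
      simp [this]
  have h2 (x : ℝ) (n : ℕ) : ∑ j ∈ Finset.range n, (j : ℝ) * (x - j) =
      x * (n * (n - 1) / 2) - (n - 1) * n * (2 * n - 1) / 6 := by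
    induction n with
    | zero => simp
    | succ n ih => rw [Finset.sum_range_succ, ih]; push_cast; ring
  rw [h1, h2]
  ring

lemma constantCoeff_quad_lie (k : ℤ) :
    constantCoeff (quad k (quad (-k) 1)) - constantCoeff (quad (-k) (quad k 1)) =
      ((k : ℝ) ^ 3 - k) / 12 := by
  wlog hk : 0 ≤ k generalizing k
  · have h := this (-k) (by omega)
    rw [neg_neg] at h
    push_cast at h
    linarith
  obtain ⟨k, rfl⟩ := Int.eq_ofNat_of_zero_le hk
  rw [constantCoeff_quad_quad_one, constantCoeff_quad_quad_one, if_pos (by omega),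
    if_pos (by omega), Finset.Icc_eq_empty (a := (k : ℤ) + 1) (by omega)]
  have := sum_neg_mul_add k
  push_cast
  rw [this, Finset.sum_empty]
  ring

lemma quad_lie (k l : ℤ) :
    quad k * quad l - quad l * quad k = ((k : ℝ) - l) • quad (k + l)
      + (if k + l = 0 then ((k : ℝ) ^ 3 - k) / 12 else 0 : ℝ) • 1 := by
  have h := eq_smul_one_of_commute
    (quad k * quad l - quad l * quad k - ((k : ℝ) - l) • quad (k + l)) fun m => by
      refine LinearMap.ext fun p => ?_
      simp only [LinearMap.sub_apply, Module.End.mul_apply, LinearMap.smul_apply, quad_mode,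
        map_sub, map_smul, add_assoc, add_left_comm l k m]
      push_cast
      module
  rw [sub_eq_iff_eq_add'] at h
  rw [h]
  congr 2
  simp only [LinearMap.sub_apply, Module.End.mul_apply, LinearMap.smul_apply, map_sub,
    constantCoeff_real_smul, constantCoeff_quad_one, mul_zero, sub_zero]
  split_ifs with hkl
  · obtain rfl : l = -k := by omega
    exact constantCoeff_quad_lie k
  · rw [constantCoeff_quad_quad_one, constantCoeff_quad_quad_one, if_neg hkl, if_neg (by omega),
      sub_zero]

end Virasoro

/-- The Virasoro relation
`[𝕁^{(2)}_{k,n}, 𝕁^{(2)}_{l,n}] = (k−l)𝕁^{(2)}_{k+l,n} − ((k³−k)/6) δ_{k,−l} id`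
as linear endomorphisms of `ℝ[t_1, t_2, …]` (stated pointwise). -/
theorem virasoro_relation (k l : ℤ) (n : ℝ) (p : MvPolynomial ℕ+ ℝ) :
    J2 k n (J2 l n p) - J2 l n (J2 k n p) =
      ((k : ℝ) - (l : ℝ)) • J2 (k + l) n p -
        (if k = -l then (((k : ℝ) ^ 3 - (k : ℝ)) / 6) else 0) • p := by
  have hq := LinearMap.congr_fun (Virasoro.quad_lie k l) p
  have hm := LinearMap.congr_fun (Virasoro.mode_mul_sub_mul k l) p
  have hkl := Virasoro.quad_mode k l p
  have hlk := Virasoro.quad_mode l k p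
  simp only [LinearMap.sub_apply, Module.End.mul_apply, LinearMap.smul_apply, LinearMap.add_apply,
    Module.End.one_apply] at hq hm
  rw [sub_eq_iff_eq_add] at hq hm
  simp only [Virasoro.J2_eq, LinearMap.add_apply, LinearMap.smul_apply, Module.End.one_apply,
    map_add, map_smul, hq, hm, hkl, hlk, add_comm l k]
  by_cases h : k + l = 0
  · obtain rfl : l = -k := by omega
    simp only [neg_neg, add_neg_cancel, if_true, neg_eq_zero]
    push_cast
    split_ifs <;> module
  · rw [if_neg h, if_neg h, if_neg h, if_neg (by omega : ¬ k = -l)]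
    push_cast
    module
end

section
/- With the notation of the context, for every permutation σ ∈ S_N and every integer k ≥ −1, the substituted and Jacobian-corrected integrand satisfies (d/dε)|_{ε=0} [ I^σ(x_1+εx_1^{k+1}, …, x_N+εx_N^{k+1}; t,s) · ∏_{i=1}^N (1+(k+1)εx_i^k) ] = ( 𝕍_k^{m,n} I^σ )(x; t,s), where 𝕍_k^{m,n} acts on I^σ as a function of the time variables and parameters with x fixed. -/
open MeasureTheory Finset

/-- Partial sum `M_k = Σ_{j<k} m_j` of the block sizes. -/
def Msum {q : ℕ} (m : Fin q → ℕ) (k : ℕ) : ℕ :=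
  ∑ j ∈ Finset.univ.filter (fun j : Fin q => (j : ℕ) < k), m j

theorem Msum_add_lt {q : ℕ} (m : Fin q → ℕ) (r : Fin q) (i : Fin (m r)) :
    Msum m (r : ℕ) + (i : ℕ) < ∑ j, m j := by
  have h2 : m r ≤ ∑ j ∈ Finset.univ.filter (fun j : Fin q => ¬ (j : ℕ) < (r : ℕ)), m j :=
    Finset.single_le_sum (fun j _ => Nat.zero_le (m j)) (by simp)
  have h3 : Msum m (r : ℕ) +
      ∑ j ∈ Finset.univ.filter (fun j : Fin q => ¬ (j : ℕ) < (r : ℕ)), m j = ∑ j, m j :=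
    Finset.sum_filter_add_sum_filter_not _ _ _
  have h4 := i.isLt
  omega

/-- The index `M_{r−1} + i` of the `i`-th element of the `r`-th block (`0`-based). -/
def blkIdx {q : ℕ} (m : Fin q → ℕ) (r : Fin q) (i : Fin (m r)) : Fin (∑ j, m j) :=
  ⟨Msum m (r : ℕ) + (i : ℕ), Msum_add_lt m r i⟩

theorem Msum_block_le {q : ℕ} (m : Fin q → ℕ) {u u' : Fin q} (h : u < u') :
    Msum m (u : ℕ) + m u ≤ Msum m (u' : ℕ) := by
  have hsub : insert u (Finset.univ.filter (fun j : Fin q => (j : ℕ) < (u : ℕ)))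
      ⊆ Finset.univ.filter (fun j : Fin q => (j : ℕ) < (u' : ℕ)) := by
    intro j hj
    simp only [Finset.mem_insert, Finset.mem_filter, Finset.mem_univ, true_and] at hj ⊢
    have huu' : (u : ℕ) < (u' : ℕ) := h
    rcases hj with rfl | hj
    · exact huu'
    · omega
  have hle := Finset.sum_le_sum_of_subset (f := m) hsub
  rw [Finset.sum_insert (by simp)] at hle
  unfold Msum
  omega

theorem blkIdx_injective {q : ℕ} (m : Fin q → ℕ) :
    Function.Injective (fun x : Σ r : Fin q, Fin (m r) => blkIdx m x.1 x.2) := by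
  rintro ⟨r, i⟩ ⟨r', i'⟩ h
  have hval : Msum m (r : ℕ) + (i : ℕ) = Msum m (r' : ℕ) + (i' : ℕ) := congrArg Fin.val h
  rcases lt_trichotomy r r' with hlt | heq | hgt
  · exact absurd hval (by have h1 := Msum_block_le m hlt; have h2 := i.isLt; omega)
  · subst heq
    have : i = i' := Fin.ext (by omega)
    rw [this]
  · exact absurd hval (by have h1 := Msum_block_le m hgt; have h2 := i'.isLt; omega)

/-- The canonical (order-preserving) equivalence between `Σ r, Fin (m r)` and `Fin (Σ m)`,
sending `(r, i)` to `M_{r−1} + i`. -/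
noncomputable def blkEquiv {q : ℕ} (m : Fin q → ℕ) : (Σ r : Fin q, Fin (m r)) ≃ Fin (∑ j, m j) :=
  Equiv.ofBijective (fun x => blkIdx m x.1 x.2)
    ((Fintype.bijective_iff_injective_and_card _).mpr
      ⟨blkIdx_injective m, by simp [Fintype.card_sigma]⟩)

/-- The Vandermonde determinant `Δ_k(y) = ∏_{i<j} (y_j − y_i)`. -/
def vdm {k : ℕ} (y : Fin k → ℝ) : ℝ :=
  ∏ i : Fin k, ∏ j ∈ Finset.Ioi i, (y j - y i)

/-- The space of time parameters `(s^{(1)},…,s^{(q)}; t^{(1)},…,t^{(p)})`. -/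
abbrev TS (q p : ℕ) := (Fin q → ℕ → ℝ) × (Fin p → ℕ → ℝ)

/-- Partial derivative `∂/∂s_ν^{(k)}` of a function of the time parameters. -/
noncomputable def dSts {q p : ℕ} (k : Fin q) (ν : ℕ) (f : TS q p → ℝ) : TS q p → ℝ :=
  fun st => deriv (fun h => f (Function.update st.1 k (Function.update (st.1 k) ν h), st.2))
    (st.1 k ν)

/-- Partial derivative `∂/∂t_ν^{(l)}` of a function of the time parameters. -/
noncomputable def dTts {q p : ℕ} (l : Fin p) (ν : ℕ) (f : TS q p → ℝ) : TS q p → ℝ :=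
  fun st => deriv (fun h => f (st.1, Function.update st.2 l (Function.update (st.2 l) ν h)))
    (st.2 l ν)

/-- `𝕁^{(1)}_{m,n}(−s^{(k)})`: the operator `∂/∂u_m + (−m)u_{−m}· + n δ_{m,0}` in the variables
`u = −s^{(k)}`, i.e. with `∂/∂s_j` replaced by `−∂/∂s_j` and `s_j·` by `(−s_j)·`. -/
noncomputable def J1S {q p : ℕ} (k : Fin q) (mm : ℤ) (nn : ℝ) (f : TS q p → ℝ) : TS q p → ℝ :=
  fun st =>
    -(if 0 < mm then dSts k mm.toNat f st else 0)
    + (-(mm : ℝ)) * (-(if 0 < -mm then st.1 k (-mm).toNat else 0)) * f st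
    + (if mm = 0 then nn else 0) * f st

/-- `𝕁^{(2)}_{m,n}(−s^{(k)})`. -/
noncomputable def J2S {q p : ℕ} (k : Fin q) (mm : ℤ) (nn : ℝ) (f : TS q p → ℝ) : TS q p → ℝ :=
  fun st =>
    (1 / 2 : ℝ) * ((∑ i ∈ Finset.Icc (1 : ℤ) (mm - 1), dSts k i.toNat (dSts k (mm - i).toNat f) st)
        + 2 * (∑ᶠ i ∈ Set.Ici (1 : ℕ), (i : ℝ) * st.1 k i *
            (if 0 < (i : ℤ) + mm then dSts k ((i : ℤ) + mm).toNat f st else 0))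
        + (∑ i ∈ Finset.Icc (1 : ℤ) (-mm - 1), (i : ℝ) * ((-mm - i : ℤ) : ℝ) *
            st.1 k i.toNat * st.1 k (-mm - i).toNat) * f st)
    + (nn + ((mm : ℝ) + 1) / 2) *
        (-(if 0 < mm then dSts k mm.toNat f st else 0)
          + (mm : ℝ) * (if 0 < -mm then st.1 k (-mm).toNat else 0) * f st)
    + (if mm = 0 then nn * (nn + 1) / 2 else 0) * f st

/-- `𝕁^{(1)}_{m,n}(t^{(l)}) = ∂/∂t_m + (−m)t_{−m}· + n δ_{m,0}`. -/
noncomputable def J1T {q p : ℕ} (l : Fin p) (mm : ℤ) (nn : ℝ) (f : TS q p → ℝ) : TS q p → ℝ :=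
  fun st =>
    (if 0 < mm then dTts l mm.toNat f st else 0)
    + (-(mm : ℝ)) * (if 0 < -mm then st.2 l (-mm).toNat else 0) * f st
    + (if mm = 0 then nn else 0) * f st

/-- `𝕁^{(2)}_{m,n}(t^{(l)})`. -/
noncomputable def J2T {q p : ℕ} (l : Fin p) (mm : ℤ) (nn : ℝ) (f : TS q p → ℝ) : TS q p → ℝ :=
  fun st =>
    (1 / 2 : ℝ) * ((∑ i ∈ Finset.Icc (1 : ℤ) (mm - 1), dTts l i.toNat (dTts l (mm - i).toNat f) st)
        + 2 * (∑ᶠ i ∈ Set.Ici (1 : ℕ), (i : ℝ) * st.2 l i *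
            (if 0 < (i : ℤ) + mm then dTts l ((i : ℤ) + mm).toNat f st else 0))
        + (∑ i ∈ Finset.Icc (1 : ℤ) (-mm - 1), (i : ℝ) * ((-mm - i : ℤ) : ℝ) *
            st.2 l i.toNat * st.2 l (-mm - i).toNat) * f st)
    + (nn + ((mm : ℝ) + 1) / 2) *
        ((if 0 < mm then dTts l mm.toNat f st else 0)
          + (-(mm : ℝ)) * (if 0 < -mm then st.2 l (-mm).toNat else 0) * f st)
    + (if mm = 0 then nn * (nn + 1) / 2 else 0) * f st

/-- The Virasoro-type operator
`𝕍_k^{m,n} = Σ_{i=1}^q [𝕁^{(2)}_{k,m_i}(−s^{(i)}) + a_i 𝕁^{(1)}_{k+1,m_i}(−s^{(i)})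
− (1−2α_i) 𝕁^{(1)}_{k+2,m_i}(−s^{(i)})] + Σ_{i=1}^p [𝕁^{(2)}_{k,n_i}(t^{(i)})
+ b_i 𝕁^{(1)}_{k+1,n_i}(t^{(i)}) + 2β_i 𝕁^{(1)}_{k+2,n_i}(t^{(i)}) − (k+1)𝕁^{(1)}_{k,n_i}(t^{(i)})]`. -/
noncomputable def Vts {q p : ℕ} (a al : Fin q → ℝ) (b be : Fin p → ℝ)
    (m : Fin q → ℕ) (n : Fin p → ℕ) (k : ℤ) (f : TS q p → ℝ) : TS q p → ℝ :=
  fun st =>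
    (∑ i : Fin q, (J2S i k ((m i : ℕ) : ℝ) f st + a i * J1S i (k + 1) ((m i : ℕ) : ℝ) f st
        - (1 - 2 * al i) * J1S i (k + 2) ((m i : ℕ) : ℝ) f st))
    + ∑ i : Fin p, (J2T i k ((n i : ℕ) : ℝ) f st + b i * J1T i (k + 1) ((n i : ℕ) : ℝ) f st
        + 2 * be i * J1T i (k + 2) ((n i : ℕ) : ℝ) f st - ((k : ℝ) + 1) * J1T i k ((n i : ℕ) : ℝ) f st)

/-- The integrand `dI^σ_{m,n}(x;(t,s))` of (4.4):
`∏_{r=1}^q [Δ_{m_r}(x-block) ∏ ψ_r^{−s}(x_i) e^{−x_i²/2}] ·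
∏_{l=1}^p [Δ_{n_l}(σ(x)-block) ∏ φ_l^t(x_{σ(i)})]`. -/
noncomputable def Isig (q p N : ℕ) (m : Fin q → ℕ) (n : Fin p → ℕ)
    (hm : ∑ r, m r = N) (hn : ∑ l, n l = N)
    (a al : Fin q → ℝ) (b be : Fin p → ℝ)
    (σ : Equiv.Perm (Fin N)) (x : Fin N → ℝ) (st : TS q p) : ℝ :=
  (∏ r : Fin q,
    (vdm (fun i : Fin (m r) => x (finCongr hm (blkIdx m r i))) *
      ∏ i : Fin (m r),
        Real.exp (a r * x (finCongr hm (blkIdx m r i))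
          + al r * (x (finCongr hm (blkIdx m r i))) ^ 2
          - (∑ᶠ ν ∈ Set.Ici (1 : ℕ), st.1 r ν * (x (finCongr hm (blkIdx m r i))) ^ ν)
          - (x (finCongr hm (blkIdx m r i))) ^ 2 / 2))) *
  ∏ l : Fin p,
    (vdm (fun j : Fin (n l) => x (σ (finCongr hn (blkIdx n l j)))) *
      ∏ j : Fin (n l),
        Real.exp (b l * x (σ (finCongr hn (blkIdx n l j)))
          + be l * (x (σ (finCongr hn (blkIdx n l j)))) ^ 2
          + ∑ᶠ ν ∈ Set.Ici (1 : ℕ), st.2 l ν * (x (σ (finCongr hn (blkIdx n l j)))) ^ ν))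

/-- The power sum `Σ_i y_i^j`. -/
def powerSum {d : ℕ} (y : Fin d → ℝ) (j : ℕ) : ℝ := ∑ i, y i ^ j

/-- The exponent `c₁ y + c₂ y² + Σ_{ν ≥ 1} u_ν y^ν`. -/
noncomputable def blockExponent (c₁ c₂ : ℝ) (u : ℕ → ℝ) (y : ℝ) : ℝ :=
  c₁ * y + c₂ * y ^ 2 + ∑ᶠ ν ∈ Set.Ici (1 : ℕ), u ν * y ^ ν

/-- The Vandermonde determinant of a block times its exponential weights. -/
noncomputable def blockWeight {d : ℕ} (c₁ c₂ : ℝ) (u : ℕ → ℝ) (y : Fin d → ℝ) : ℝ :=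
  vdm y * ∏ i, Real.exp (blockExponent c₁ c₂ u (y i))

/-- The logarithmic derivative of the Vandermonde determinant along `Σ_i y_i^K ∂/∂y_i`,
as a polynomial in `y`. -/
def vdmLogDeriv {d : ℕ} (K : ℕ) (y : Fin d → ℝ) : ℝ :=
  ∑ i : Fin d, ∑ j ∈ Finset.Ioi i, ∑ a ∈ Finset.range K, y j ^ a * y i ^ (K - 1 - a)

/-- The value of `𝕁^{(1)}_{k,n}(u)` with every `∂/∂u_j` replaced by the number `P j`. -/
def symbolJ1 (k : ℤ) (n : ℝ) (u P : ℕ → ℝ) : ℝ :=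
  (if 0 < k then P k.toNat else 0) + (-(k : ℝ)) * (if 0 < -k then u (-k).toNat else 0)
    + (if k = 0 then n else 0)

/-- The value of `𝕁^{(2)}_{k,n}(u)` with every `∂/∂u_j` replaced by the number `P j`. -/
noncomputable def symbolJ2 (k : ℤ) (n : ℝ) (u P : ℕ → ℝ) : ℝ :=
  (1 / 2 : ℝ) * ((∑ i ∈ Finset.Icc (1 : ℤ) (k - 1), P i.toNat * P (k - i).toNat)
      + 2 * (∑ᶠ i ∈ Set.Ici (1 : ℕ), (i : ℝ) * u i *
          (if 0 < (i : ℤ) + k then P ((i : ℤ) + k).toNat else 0))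
      + ∑ i ∈ Finset.Icc (1 : ℤ) (-k - 1), (i : ℝ) * ((-k - i : ℤ) : ℝ) *
          u i.toNat * u (-k - i).toNat)
  + (n + ((k : ℝ) + 1) / 2) *
      ((if 0 < k then P k.toNat else 0)
        + (-(k : ℝ)) * (if 0 < -k then u (-k).toNat else 0))
  + (if k = 0 then n * (n + 1) / 2 else 0)

theorem finsum_mem_Ici_one_eq_sum {u F : ℕ → ℝ} (hu : (Function.support u).Finite)
    (hF : ∀ ν, u ν = 0 → F ν = 0) :
    ∑ᶠ ν ∈ Set.Ici (1 : ℕ), F ν = ∑ ν ∈ hu.toFinset.filter (1 ≤ ·), F ν := by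
  apply finsum_mem_eq_sum_of_subset
  · rintro ν ⟨h1, h2⟩
    simp only [Finset.coe_filter, Set.Finite.mem_toFinset, Function.mem_support, Set.mem_ofPred_eq]
    exact ⟨fun h => h2 (hF ν h), h1⟩
  · intro ν hν
    simp only [Finset.coe_filter, Set.mem_ofPred_eq] at hν
    exact hν.2

theorem hasDerivAt_prod_of_mul {ι : Type*} (s : Finset ι) {f : ι → ℝ → ℝ} {c : ι → ℝ} {z : ℝ}
    (h : ∀ i ∈ s, HasDerivAt (f i) (c i * f i z) z) :
    HasDerivAt (fun w => ∏ i ∈ s, f i w) ((∑ i ∈ s, c i) * ∏ i ∈ s, f i z) z := by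
  classical
  induction s using Finset.induction_on with
  | empty => simpa using hasDerivAt_const z (1 : ℝ)
  | insert i s hi ih =>
    simp only [Finset.prod_insert hi, Finset.sum_insert hi]
    convert! (h i (by simp)).mul (ih fun j hj => h j (by simp [hj])) using 1
    ring

theorem vdm_add_mul_pow {d : ℕ} (K : ℕ) (y : Fin d → ℝ) (ε : ℝ) :
    vdm (fun i => y i + ε * y i ^ K) = vdm y * ∏ i : Fin d, ∏ j ∈ Finset.Ioi i,
      (1 + ε * ∑ a ∈ Finset.range K, y j ^ a * y i ^ (K - 1 - a)) := by
  simp only [vdm, ← Finset.prod_mul_distrib]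
  refine Finset.prod_congr rfl fun i _ => Finset.prod_congr rfl fun j _ => ?_
  linear_combination (-ε) * (Commute.all (y j) (y i)).geom_sum₂_mul K

theorem hasDerivAt_one_add_mul (c : ℝ) : HasDerivAt (fun ε : ℝ => 1 + ε * c) c 0 := by
  simpa using ((hasDerivAt_id (0 : ℝ)).mul_const c).const_add 1

theorem hasDerivAt_vdm {d : ℕ} (K : ℕ) (y : Fin d → ℝ) :
    HasDerivAt (fun ε : ℝ => vdm (fun i => y i + ε * y i ^ K)) (vdmLogDeriv K y * vdm y) 0 := by
  simp only [vdm_add_mul_pow]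
  have h := hasDerivAt_prod_of_mul (z := 0) Finset.univ
    (f := fun (i : Fin d) ε => ∏ j ∈ Finset.Ioi i,
      (1 + ε * ∑ a ∈ Finset.range K, y j ^ a * y i ^ (K - 1 - a)))
    (c := fun i => ∑ j ∈ Finset.Ioi i, ∑ a ∈ Finset.range K, y j ^ a * y i ^ (K - 1 - a))
    (fun i _ => hasDerivAt_prod_of_mul _ fun j _ => by
      simpa using hasDerivAt_one_add_mul
        (∑ a ∈ Finset.range K, y j ^ a * y i ^ (K - 1 - a)))
  convert! h.const_mul (vdm y) using 1
  simp [vdmLogDeriv, mul_comm]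

theorem hasDerivAt_blockExponent (c₁ c₂ : ℝ) {u : ℕ → ℝ} (hu : (Function.support u).Finite)
    (K : ℕ) (y : ℝ) :
    HasDerivAt (fun ε : ℝ => blockExponent c₁ c₂ u (y + ε * y ^ K))
      (c₁ * y ^ K + 2 * c₂ * y ^ (K + 1)
        + ∑ᶠ ν ∈ Set.Ici (1 : ℕ), ν * u ν * y ^ (ν - 1 + K)) 0 := by
  have hy : HasDerivAt (fun ε : ℝ => y + ε * y ^ K) (y ^ K) 0 := by
    simpa using ((hasDerivAt_id (0 : ℝ)).mul_const (y ^ K)).const_add y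
  have hpow (ν : ℕ) : HasDerivAt (fun ε : ℝ => (y + ε * y ^ K) ^ ν)
      (ν * y ^ (ν - 1) * y ^ K) 0 := by
    simpa using hy.fun_pow ν
  unfold blockExponent
  rw [finsum_mem_Ici_one_eq_sum hu (by simp +contextual)]
  simp_rw [fun z : ℝ => finsum_mem_Ici_one_eq_sum (F := fun ν => u ν * z ^ ν) hu
    (by simp +contextual)]
  convert! ((hy.const_mul c₁).add ((hpow 2).const_mul c₂)).add
    (HasDerivAt.fun_sum fun ν _ => (hpow ν).const_mul (u ν)) using 1
  congr 1
  · push_cast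
    ring
  · exact Finset.sum_congr rfl fun ν _ => by ring

theorem hasDerivAt_blockWeight {d : ℕ} (c₁ c₂ : ℝ) {u : ℕ → ℝ}
    (hu : (Function.support u).Finite) (K : ℕ) (y : Fin d → ℝ) :
    HasDerivAt (fun ε : ℝ => blockWeight c₁ c₂ u (fun i => y i + ε * y i ^ K))
      ((vdmLogDeriv K y + c₁ * powerSum y K + 2 * c₂ * powerSum y (K + 1)
        + ∑ᶠ ν ∈ Set.Ici (1 : ℕ), ν * u ν * powerSum y (ν - 1 + K))
        * blockWeight c₁ c₂ u y) 0 := by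
  have h := (hasDerivAt_vdm K y).mul (hasDerivAt_prod_of_mul Finset.univ fun i _ => by
    have := (hasDerivAt_blockExponent c₁ c₂ hu K (y i)).exp
    rwa [mul_comm] at this)
  simp only [zero_mul, add_zero] at h
  convert! h using 1
  rw [Finset.sum_add_distrib, Finset.sum_add_distrib, ← Finset.mul_sum, ← Finset.mul_sum]
  simp_rw [fun z : ℝ => finsum_mem_Ici_one_eq_sum (F := fun ν => ν * u ν * z ^ (ν - 1 + K)) hu
    (by simp +contextual)]
  rw [finsum_mem_Ici_one_eq_sum hu (by simp +contextual), Finset.sum_comm]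
  simp only [← Finset.mul_sum, blockWeight, powerSum]
  ring

theorem two_mul_vdmLogDeriv_add {d : ℕ} (K : ℕ) (y : Fin d → ℝ) :
    2 * vdmLogDeriv K y + K * powerSum y (K - 1)
      = ∑ a ∈ Finset.range K, powerSum y a * powerSum y (K - 1 - a) := by
  set g : Fin d → Fin d → ℝ := fun j i => ∑ a ∈ Finset.range K, y j ^ a * y i ^ (K - 1 - a)
    with hg
  have hsymm (i j : Fin d) : g i j = g j i := (Commute.all (y i) (y j)).geom_sum₂_comm K
  have hoff : 2 * vdmLogDeriv K y = ∑ i, ∑ j ∈ ({i}ᶜ : Finset (Fin d)), g j i := by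
    rw [← Finset.sum_sum_Ioi_add_eq_sum_sum_off_diag, vdmLogDeriv, Finset.mul_sum]
    refine Finset.sum_congr rfl fun i _ => ?_
    rw [Finset.mul_sum]
    exact Finset.sum_congr rfl fun j _ => by rw [hsymm i j, two_mul]
  have hdiag : K * powerSum y (K - 1) = ∑ i, g i i := by
    rw [powerSum, Finset.mul_sum]
    exact Finset.sum_congr rfl fun i _ => (geom_sum₂_self (y i) K).symm
  rw [hoff, hdiag, ← Finset.sum_add_distrib]
  simp_rw [powerSum, Finset.sum_mul_sum]
  rw [Finset.sum_comm]
  simp_rw [Finset.sum_comm (s := Finset.range K)]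
  rw [Finset.sum_comm]
  refine Finset.sum_congr rfl fun i _ => ?_
  rw [add_comm, ← Fintype.sum_eq_add_sum_compl i fun j => g j i]

theorem finsum_symbolJ2_eq {u : ℕ → ℝ} (hu : (Function.support u).Finite) (K : ℕ) (P : ℕ → ℝ) :
    (∑ᶠ i ∈ Set.Ici (1 : ℕ), (i : ℝ) * u i *
      (if 0 < (i : ℤ) + ((K : ℤ) - 1) then P ((i : ℤ) + ((K : ℤ) - 1)).toNat else 0))
      = (∑ᶠ ν ∈ Set.Ici (1 : ℕ), ν * u ν * P (ν - 1 + K)) - if K = 0 then u 1 * P 0 else 0 := by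
  rw [finsum_mem_Ici_one_eq_sum hu (by simp +contextual),
    finsum_mem_Ici_one_eq_sum hu (by simp +contextual)]
  have hterm : ∀ i ∈ hu.toFinset.filter (1 ≤ ·), (i : ℝ) * u i *
      (if 0 < (i : ℤ) + ((K : ℤ) - 1) then P ((i : ℤ) + ((K : ℤ) - 1)).toNat else 0)
      = i * u i * P (i - 1 + K) - if i = 1 then (if K = 0 then u 1 * P 0 else 0) else 0 := by
    intro i hi
    have h1 : 1 ≤ i := (Finset.mem_filter.mp hi).2
    have hnat : ((i : ℤ) + ((K : ℤ) - 1)).toNat = i - 1 + K := by omega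
    rw [hnat]
    by_cases hpos : 0 < (i : ℤ) + ((K : ℤ) - 1)
    · have : ¬ (i = 1 ∧ K = 0) := by omega
      rw [if_pos hpos, ← ite_and, if_neg this, sub_zero]
    · obtain ⟨rfl, rfl⟩ : i = 1 ∧ K = 0 := by omega
      simp
  rw [Finset.sum_congr rfl hterm, Finset.sum_sub_distrib, Finset.sum_ite_eq']
  by_cases h1 : u 1 = 0 <;> simp [h1]

theorem sum_Icc_int_eq_sum_range (K : ℕ) (P : ℕ → ℝ) :
    ∑ i ∈ Finset.Icc (1 : ℤ) K, P i.toNat * P ((K : ℤ) + 1 - i).toNat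
      = ∑ a ∈ Finset.range K, P (a + 1) * P (K - a) := by
  refine Finset.sum_nbij' (fun i => i.toNat - 1) (fun a => (a : ℤ) + 1) ?_ ?_ ?_ ?_ ?_
  · intro i hi
    simp only [Finset.mem_Icc, Finset.mem_range] at *
    omega
  · intro a ha
    simp only [Finset.mem_Icc, Finset.mem_range] at *
    omega
  · intro i hi
    simp only [Finset.mem_Icc] at *
    omega
  · intro a _
    omega
  · intro i hi
    simp only [Finset.mem_Icc] at hi
    congr 2 <;> omega

theorem symbolJ2_powerSum {d : ℕ} {u : ℕ → ℝ} (hu : (Function.support u).Finite) (K : ℕ)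
    (y : Fin d → ℝ) :
    symbolJ2 ((K : ℤ) - 1) d u (powerSum y) = vdmLogDeriv K y
      + (∑ᶠ ν ∈ Set.Ici (1 : ℕ), ν * u ν * powerSum y (ν - 1 + K)) + K * powerSum y (K - 1) := by
  have hP0 : powerSum y 0 = d := by simp [powerSum]
  have hvdm := two_mul_vdmLogDeriv_add K y
  have hempty : Finset.Icc (1 : ℤ) (-((K : ℤ) - 1) - 1) = ∅ := by
    apply Finset.Icc_eq_empty
    omega
  rw [symbolJ2, finsum_symbolJ2_eq hu, hempty, Finset.sum_empty]
  rcases K with _ | _ | K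
  · simp only [Finset.range_zero, Finset.sum_empty] at hvdm
    norm_num at hvdm ⊢
    rw [hvdm, hP0]
    ring
  · norm_num at hvdm ⊢
    rw [hP0] at hvdm ⊢
    linear_combination (-1 / 2) * hvdm
  · have hcast : (((K + 1 + 1 : ℕ) : ℤ) - 1) = (K : ℤ) + 1 := by
      push_cast
      ring
    have hpos : (0 : ℤ) < K + 1 := by omega
    have hnneg : ¬ (0 : ℤ) < -(K + 1) := by omega
    have hne : (K : ℤ) + 1 ≠ 0 := by omega
    have hnat : ((K : ℤ) + 1).toNat = K + 1 := by omega
    rw [hcast, if_pos hpos, if_neg hnneg, if_neg hne, hnat, if_neg (by omega),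
      add_sub_cancel_right, sum_Icc_int_eq_sum_range]
    rw [Finset.sum_range_succ, Finset.sum_range_succ'] at hvdm
    have hsum : ∑ a ∈ Finset.range K, powerSum y (a + 1) * powerSum y (K + 1 + 1 - 1 - (a + 1))
        = ∑ a ∈ Finset.range K, powerSum y (a + 1) * powerSum y (K - a) :=
      Finset.sum_congr rfl fun a _ => by
        congr 2
        omega
    rw [hsum] at hvdm
    simp only [Nat.add_sub_cancel, Nat.sub_zero, Nat.sub_self, hP0] at hvdm ⊢
    push_cast at hvdm ⊢
    linear_combination (-1 / 2) * hvdm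

theorem symbolJ1_powerSum {d : ℕ} (u : ℕ → ℝ) (K : ℕ) (y : Fin d → ℝ) :
    symbolJ1 K d u (powerSum y) = powerSum y K := by
  rcases K with _ | K
  · simp [symbolJ1, powerSum]
  · have h' : (K : ℤ) + 1 ≠ 0 := by omega
    have h'' : (0 : ℤ) < K + 1 := by omega
    have h3 : ((K : ℤ) + 1).toNat = K + 1 := by omega
    simp [symbolJ1, h', h'', h3]

theorem powerSum_zpow {d : ℕ} (K : ℕ) (y : Fin d → ℝ) :
    ∑ i, (((K : ℤ) - 1 : ℤ) + 1 : ℝ) * y i ^ ((K : ℤ) - 1) = K * powerSum y (K - 1) := by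
  rcases K with _ | K
  · simp
  · simp [powerSum, Finset.mul_sum]

theorem symbolJ1_pred_powerSum {d : ℕ} (u : ℕ → ℝ) (K : ℕ) (y : Fin d → ℝ) :
    (((K : ℤ) - 1 : ℤ) + 1 : ℝ) * symbolJ1 ((K : ℤ) - 1) d u (powerSum y)
      = K * powerSum y (K - 1) := by
  rcases K with _ | K
  · simp
  · rw [Nat.add_sub_cancel, ← symbolJ1_powerSum u K y]
    push_cast
    rw [add_sub_cancel_right, add_sub_cancel_right]

theorem blockWeight_update {d : ℕ} (c₁ c₂ : ℝ) {u : ℕ → ℝ} (hu : (Function.support u).Finite)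
    (y : Fin d → ℝ) {j : ℕ} (hj : 1 ≤ j) (h : ℝ) :
    blockWeight c₁ c₂ (Function.update u j h) y
      = blockWeight c₁ c₂ u y * Real.exp ((h - u j) * powerSum y j) := by
  have hexp (z : ℝ) : blockExponent c₁ c₂ (Function.update u j h) z
      = blockExponent c₁ c₂ u z + (h - u j) * z ^ j := by
    have hupd : Function.update u j h = fun ν => u ν + if ν = j then h - u j else 0 := by
      ext ν
      by_cases hν : ν = j
      · subst hν
        simp
      · simp [hν]
    have hfin (S : Set ℕ) (F : ℕ → ℝ) (hF : ∀ ν, u ν = 0 → F ν = 0) :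
        (S ∩ Function.support F).Finite :=
      hu.subset fun ν hν h0 => hν.2 (hF ν h0)
    unfold blockExponent
    rw [hupd]
    simp only [add_mul]
    rw [finsum_mem_add_distrib' (hfin _ _ (by simp +contextual))
      ((Set.finite_singleton j).subset (by
        rintro ν ⟨-, hν⟩
        by_contra hne
        exact hν (by simp [show ν ≠ j from hne])))]
    rw [finsum_mem_eq_sum_of_subset (t := {j}) (s := Set.Ici 1)
      (fun ν => (if ν = j then h - u j else 0) * z ^ ν)]
    · simp
      ring
    · rintro ν ⟨-, hν⟩
      by_contra hne
      exact hν (by simp [show ν ≠ j by simpa using hne])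
    · simpa using hj
  simp only [blockWeight, hexp, Real.exp_add, Finset.prod_mul_distrib, ← Real.exp_sum,
    ← Finset.mul_sum, powerSum, mul_assoc]

/-- The points of the `r`-th block. -/
def blockPoints {q N : ℕ} (m : Fin q → ℕ) (hm : ∑ r, m r = N) (x : Fin N → ℝ) (r : Fin q) :
    Fin (m r) → ℝ :=
  fun i => x (finCongr hm (blkIdx m r i))

theorem sum_blocks {q N : ℕ} (m : Fin q → ℕ) (hm : ∑ r, m r = N) (g : Fin N → ℝ) :
    ∑ r, ∑ i, g (finCongr hm (blkIdx m r i)) = ∑ i, g i := by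
  rw [← ((blkEquiv m).trans (finCongr hm)).sum_comp, Fintype.sum_sigma]
  rfl

theorem Isig_eq (q p N : ℕ) (m : Fin q → ℕ) (n : Fin p → ℕ)
    (hm : ∑ r, m r = N) (hn : ∑ l, n l = N) (a al : Fin q → ℝ) (b be : Fin p → ℝ)
    (σ : Equiv.Perm (Fin N)) (x : Fin N → ℝ) (st : TS q p) :
    Isig q p N m n hm hn a al b be σ x st =
      (∏ r, blockWeight (a r) (al r - 1 / 2) (-st.1 r) (blockPoints m hm x r)) *
        ∏ l, blockWeight (b l) (be l) (st.2 l) (blockPoints n hn (x ∘ σ) l) := by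
  have hexp (c₁ c₂ : ℝ) (u : ℕ → ℝ) (z : ℝ) :
      c₁ * z + c₂ * z ^ 2 - (∑ᶠ ν ∈ Set.Ici (1 : ℕ), u ν * z ^ ν) - z ^ 2 / 2
        = blockExponent c₁ (c₂ - 1 / 2) (-u) z := by
    simp only [blockExponent, Pi.neg_apply, neg_mul, finsum_neg_distrib]
    ring
  unfold Isig
  simp only [hexp]
  rfl

theorem prod_update_blockWeight {q : ℕ} {m : Fin q → ℕ} (c₁ c₂ : Fin q → ℝ) {u : Fin q → ℕ → ℝ}
    (hu : ∀ r, (Function.support (u r)).Finite) (y : ∀ r, Fin (m r) → ℝ) (k : Fin q) {j : ℕ}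
    (hj : 1 ≤ j) (h : ℝ) :
    ∏ r, blockWeight (c₁ r) (c₂ r) (Function.update u k (Function.update (u k) j h) r) (y r)
      = (∏ r, blockWeight (c₁ r) (c₂ r) (u r) (y r))
        * Real.exp ((h - u k j) * powerSum (y k) j) := by
  have hterm (r : Fin q) :
      blockWeight (c₁ r) (c₂ r) (Function.update u k (Function.update (u k) j h) r) (y r)
      = blockWeight (c₁ r) (c₂ r) (u r) (y r)
        * if r = k then Real.exp ((h - u k j) * powerSum (y k) j) else 1 := by
    by_cases hr : r = k
    · subst hr
      simp [blockWeight_update _ _ (hu r) _ hj]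
    · simp [hr]
  simp only [hterm, Finset.prod_mul_distrib, Finset.prod_ite_eq', Finset.mem_univ, if_true]

theorem support_update_update_finite {q : ℕ} {u : Fin q → ℕ → ℝ}
    (hu : ∀ r, (Function.support (u r)).Finite) (k : Fin q) (j : ℕ) (h : ℝ) (r : Fin q) :
    (Function.support (Function.update u k (Function.update (u k) j h) r)).Finite := by
  by_cases hr : r = k
  · subst hr
    rw [Function.update_self]
    refine ((hu r).insert j).subset fun ν hν => ?_
    by_cases hνj : ν = j
    · exact Or.inl hνj
    · right
      simpa [hνj] using hν
  · simpa [hr] using hu r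

theorem deriv_mul_exp_sub (A c z : ℝ) :
    deriv (fun h => A * Real.exp ((h - z) * c)) z = c * A := by
  have h := ((((hasDerivAt_id z).sub_const z).mul_const c).exp).const_mul A
  simpa [mul_comm] using h.deriv

theorem J1S_eq {q p : ℕ} {k : Fin q} {f : TS q p → ℝ} {st : TS q p} {P : ℕ → ℝ}
    (h1 : ∀ j, 1 ≤ j → dSts k j f st = -P j * f st) (mm : ℤ) (nn : ℝ) :
    J1S k mm nn f st = symbolJ1 mm nn (-st.1 k) P * f st := by
  unfold J1S symbolJ1
  by_cases hmm : 0 < mm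
  · rw [if_pos hmm, if_pos hmm, h1 _ (by omega)]
    simp only [Pi.neg_apply]
    split_ifs <;> ring
  · rw [if_neg hmm, if_neg hmm]
    simp only [Pi.neg_apply]
    split_ifs <;> ring

theorem J1T_eq {q p : ℕ} {k : Fin p} {f : TS q p → ℝ} {st : TS q p} {P : ℕ → ℝ}
    (h1 : ∀ j, 1 ≤ j → dTts k j f st = P j * f st) (mm : ℤ) (nn : ℝ) :
    J1T k mm nn f st = symbolJ1 mm nn (st.2 k) P * f st := by
  unfold J1T symbolJ1
  by_cases hmm : 0 < mm
  · rw [if_pos hmm, if_pos hmm, h1 _ (by omega)]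
    ring
  · rw [if_neg hmm, if_neg hmm]
    ring

theorem J2T_eq {q p : ℕ} {k : Fin p} {f : TS q p → ℝ} {st : TS q p} {P : ℕ → ℝ}
    (hfin : (Function.support (st.2 k)).Finite)
    (h1 : ∀ j, 1 ≤ j → dTts k j f st = P j * f st)
    (h2 : ∀ i j, 1 ≤ i → 1 ≤ j → dTts k i (dTts k j f) st = P i * P j * f st)
    (mm : ℤ) (nn : ℝ) :
    J2T k mm nn f st = symbolJ2 mm nn (st.2 k) P * f st := by
  have hd (j : ℤ) : (if 0 < j then dTts k j.toNat f st else 0)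
      = (if 0 < j then P j.toNat else 0) * f st := by
    split_ifs with hj
    · exact h1 _ (by omega)
    · simp
  have hquad : ∑ i ∈ Finset.Icc (1 : ℤ) (mm - 1), dTts k i.toNat (dTts k (mm - i).toNat f) st
      = (∑ i ∈ Finset.Icc (1 : ℤ) (mm - 1), P i.toNat * P (mm - i).toNat) * f st := by
    rw [Finset.sum_mul]
    refine Finset.sum_congr rfl fun i hi => ?_
    rw [Finset.mem_Icc] at hi
    exact h2 _ _ (by omega) (by omega)
  unfold J2T symbolJ2
  rw [hquad, finsum_mem_Ici_one_eq_sum hfin (by simp +contextual),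
    finsum_mem_Ici_one_eq_sum hfin (by simp +contextual)]
  simp only [hd, ← mul_assoc, ← Finset.sum_mul]
  ring

theorem J2S_eq {q p : ℕ} {k : Fin q} {f : TS q p → ℝ} {st : TS q p} {P : ℕ → ℝ}
    (hfin : (Function.support (st.1 k)).Finite)
    (h1 : ∀ j, 1 ≤ j → dSts k j f st = -P j * f st)
    (h2 : ∀ i j, 1 ≤ i → 1 ≤ j → dSts k i (dSts k j f) st = P i * P j * f st)
    (mm : ℤ) (nn : ℝ) :
    J2S k mm nn f st = symbolJ2 mm nn (-st.1 k) P * f st := by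
  have hd (j : ℤ) : (if 0 < j then dSts k j.toNat f st else 0)
      = -((if 0 < j then P j.toNat else 0) * f st) := by
    split_ifs with hj
    · rw [h1 _ (by omega), neg_mul]
    · simp
  have hquad : ∑ i ∈ Finset.Icc (1 : ℤ) (mm - 1), dSts k i.toNat (dSts k (mm - i).toNat f) st
      = (∑ i ∈ Finset.Icc (1 : ℤ) (mm - 1), P i.toNat * P (mm - i).toNat) * f st := by
    rw [Finset.sum_mul]
    refine Finset.sum_congr rfl fun i hi => ?_
    rw [Finset.mem_Icc] at hi
    exact h2 _ _ (by omega) (by omega)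
  have hneg : (if 0 < -mm then (-st.1 k) (-mm).toNat else 0)
      = -(if 0 < -mm then st.1 k (-mm).toNat else 0) := by
    split_ifs <;> simp
  unfold J2S symbolJ2
  rw [hquad, hneg, finsum_mem_Ici_one_eq_sum hfin (by simp +contextual),
    finsum_mem_Ici_one_eq_sum hfin (by simp +contextual)]
  simp only [hd, Pi.neg_apply, mul_neg, neg_mul, neg_neg, ← mul_assoc, ← Finset.sum_mul,
    Finset.sum_neg_distrib]
  ring

section TimeDerivatives

variable {q p N : ℕ} {m : Fin q → ℕ} {n : Fin p → ℕ} (hm : ∑ r, m r = N) (hn : ∑ l, n l = N)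
  (a al : Fin q → ℝ) (b be : Fin p → ℝ) (σ : Equiv.Perm (Fin N)) (x : Fin N → ℝ)
  {st : TS q p}

theorem Isig_update_fst (hs : ∀ i, (Function.support (st.1 i)).Finite) (r : Fin q) {j : ℕ}
    (hj : 1 ≤ j) (h : ℝ) :
    Isig q p N m n hm hn a al b be σ x
        (Function.update st.1 r (Function.update (st.1 r) j h), st.2)
      = Isig q p N m n hm hn a al b be σ x st
        * Real.exp ((h - st.1 r j) * -powerSum (blockPoints m hm x r) j) := by
  have hs' (i : Fin q) : (Function.support ((-st.1) i)).Finite := by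
    simpa [Function.support_neg] using hs i
  have hupd : Function.update (-st.1) r (Function.update ((-st.1) r) j (-h))
      = -Function.update st.1 r (Function.update (st.1 r) j h) := by
    ext i ν
    by_cases hi : i = r
    · subst hi
      by_cases hν : ν = j
      · subst hν
        simp
      · simp [hν]
    · simp [hi]
  have hprod := prod_update_blockWeight a (fun r => al r - 1 / 2) hs' (blockPoints m hm x) r hj
    (-h)
  rw [hupd] at hprod
  simp only [Pi.neg_apply] at hprod
  rw [Isig_eq, Isig_eq, hprod,
    show (-h - -st.1 r j) * powerSum (blockPoints m hm x r) j
      = (h - st.1 r j) * -powerSum (blockPoints m hm x r) j by ring]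
  ring

theorem Isig_update_snd (ht : ∀ i, (Function.support (st.2 i)).Finite) (l : Fin p) {j : ℕ}
    (hj : 1 ≤ j) (h : ℝ) :
    Isig q p N m n hm hn a al b be σ x
        (st.1, Function.update st.2 l (Function.update (st.2 l) j h))
      = Isig q p N m n hm hn a al b be σ x st
        * Real.exp ((h - st.2 l j) * powerSum (blockPoints n hn (x ∘ σ) l) j) := by
  rw [Isig_eq, Isig_eq, prod_update_blockWeight b be ht (blockPoints n hn (x ∘ σ)) l hj]
  ring

theorem dSts_Isig (hs : ∀ i, (Function.support (st.1 i)).Finite) (r : Fin q) {j : ℕ}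
    (hj : 1 ≤ j) :
    dSts r j (Isig q p N m n hm hn a al b be σ x) st
      = -powerSum (blockPoints m hm x r) j * Isig q p N m n hm hn a al b be σ x st := by
  unfold dSts
  simp only [Isig_update_fst hm hn a al b be σ x hs r hj]
  exact deriv_mul_exp_sub _ _ _

theorem dTts_Isig (ht : ∀ i, (Function.support (st.2 i)).Finite) (l : Fin p) {j : ℕ}
    (hj : 1 ≤ j) :
    dTts l j (Isig q p N m n hm hn a al b be σ x) st
      = powerSum (blockPoints n hn (x ∘ σ) l) j * Isig q p N m n hm hn a al b be σ x st := by
  unfold dTts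
  simp only [Isig_update_snd hm hn a al b be σ x ht l hj]
  exact deriv_mul_exp_sub _ _ _

theorem dSts_dSts_Isig (hs : ∀ i, (Function.support (st.1 i)).Finite) (r : Fin q) {i j : ℕ}
    (hi : 1 ≤ i) (hj : 1 ≤ j) :
    dSts r i (dSts r j (Isig q p N m n hm hn a al b be σ x)) st
      = powerSum (blockPoints m hm x r) i * powerSum (blockPoints m hm x r) j
        * Isig q p N m n hm hn a al b be σ x st := by
  rw [dSts]
  simp only [dSts_Isig hm hn a al b be σ x
    (st := (Function.update st.1 r (Function.update (st.1 r) i _), st.2))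
    (support_update_update_finite hs r i _) r hj,
    Isig_update_fst hm hn a al b be σ x hs r hi, ← mul_assoc]
  rw [deriv_mul_exp_sub]
  ring

theorem dTts_dTts_Isig (ht : ∀ i, (Function.support (st.2 i)).Finite) (l : Fin p) {i j : ℕ}
    (hi : 1 ≤ i) (hj : 1 ≤ j) :
    dTts l i (dTts l j (Isig q p N m n hm hn a al b be σ x)) st
      = powerSum (blockPoints n hn (x ∘ σ) l) i * powerSum (blockPoints n hn (x ∘ σ) l) j
        * Isig q p N m n hm hn a al b be σ x st := by
  rw [dTts]
  simp only [dTts_Isig hm hn a al b be σ x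
    (st := (st.1, Function.update st.2 l (Function.update (st.2 l) i _)))
    (support_update_update_finite ht l i _) l hj,
    Isig_update_snd hm hn a al b be σ x ht l hi, ← mul_assoc]
  rw [deriv_mul_exp_sub]
  ring

theorem Vts_Isig (hs : ∀ i, (Function.support (st.1 i)).Finite)
    (ht : ∀ i, (Function.support (st.2 i)).Finite) (K : ℕ) :
    Vts a al b be m n ((K : ℤ) - 1) (Isig q p N m n hm hn a al b be σ x) st
      = ((∑ r, (vdmLogDeriv K (blockPoints m hm x r) + a r * powerSum (blockPoints m hm x r) K
            + 2 * (al r - 1 / 2) * powerSum (blockPoints m hm x r) (K + 1)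
            + (∑ᶠ ν ∈ Set.Ici (1 : ℕ),
              ν * (-st.1 r) ν * powerSum (blockPoints m hm x r) (ν - 1 + K))
            + K * powerSum (blockPoints m hm x r) (K - 1)))
        + ∑ l, (vdmLogDeriv K (blockPoints n hn (x ∘ σ) l)
            + b l * powerSum (blockPoints n hn (x ∘ σ) l) K
            + 2 * be l * powerSum (blockPoints n hn (x ∘ σ) l) (K + 1)
            + ∑ᶠ ν ∈ Set.Ici (1 : ℕ),
              ν * st.2 l ν * powerSum (blockPoints n hn (x ∘ σ) l) (ν - 1 + K)))
        * Isig q p N m n hm hn a al b be σ x st := by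
  have hk1 : (K : ℤ) - 1 + 1 = (K : ℕ) := by omega
  have hk2 : (K : ℤ) - 1 + 2 = (K + 1 : ℕ) := by omega
  unfold Vts
  rw [hk1, hk2, add_mul, Finset.sum_mul, Finset.sum_mul]
  congr 1
  · refine Finset.sum_congr rfl fun r _ => ?_
    have h1 (j : ℕ) (hj : 1 ≤ j) := dSts_Isig hm hn a al b be σ x hs r hj
    have h2 (i j : ℕ) (hi : 1 ≤ i) (hj : 1 ≤ j) := dSts_dSts_Isig hm hn a al b be σ x hs r hi hj
    have hneg : (Function.support (-st.1 r)).Finite := by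
      simpa only [Function.support_neg] using hs r
    rw [J2S_eq (hs r) h1 h2, J1S_eq h1, J1S_eq h1, symbolJ2_powerSum hneg, symbolJ1_powerSum,
      symbolJ1_powerSum]
    ring
  · refine Finset.sum_congr rfl fun l _ => ?_
    have h1 (j : ℕ) (hj : 1 ≤ j) := dTts_Isig hm hn a al b be σ x ht l hj
    have h2 (i j : ℕ) (hi : 1 ≤ i) (hj : 1 ≤ j) := dTts_dTts_Isig hm hn a al b be σ x ht l hi hj
    rw [J2T_eq (ht l) h1 h2, J1T_eq h1, J1T_eq h1, J1T_eq h1, symbolJ2_powerSum (ht l),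
      symbolJ1_powerSum, symbolJ1_powerSum, ← mul_assoc (_ + 1), symbolJ1_pred_powerSum]
    ring

theorem hasDerivAt_Isig (hs : ∀ i, (Function.support (st.1 i)).Finite)
    (ht : ∀ i, (Function.support (st.2 i)).Finite) (K : ℕ) :
    HasDerivAt (fun ε : ℝ => Isig q p N m n hm hn a al b be σ (fun i => x i + ε * x i ^ K) st)
      (((∑ r, (vdmLogDeriv K (blockPoints m hm x r) + a r * powerSum (blockPoints m hm x r) K
            + 2 * (al r - 1 / 2) * powerSum (blockPoints m hm x r) (K + 1)
            + ∑ᶠ ν ∈ Set.Ici (1 : ℕ),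
              ν * (-st.1 r) ν * powerSum (blockPoints m hm x r) (ν - 1 + K)))
        + ∑ l, (vdmLogDeriv K (blockPoints n hn (x ∘ σ) l)
            + b l * powerSum (blockPoints n hn (x ∘ σ) l) K
            + 2 * be l * powerSum (blockPoints n hn (x ∘ σ) l) (K + 1)
            + ∑ᶠ ν ∈ Set.Ici (1 : ℕ),
              ν * st.2 l ν * powerSum (blockPoints n hn (x ∘ σ) l) (ν - 1 + K)))
        * Isig q p N m n hm hn a al b be σ x st) 0 := by
  have hneg (r : Fin q) : (Function.support (-st.1 r)).Finite := by
    simpa only [Function.support_neg] using hs r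
  have hS := hasDerivAt_prod_of_mul (z := 0) Finset.univ
    (f := fun r ε => blockWeight (a r) (al r - 1 / 2) (-st.1 r)
      fun i => blockPoints m hm x r i + ε * blockPoints m hm x r i ^ K) fun r _ => by
    simpa only [zero_mul, add_zero] using
      hasDerivAt_blockWeight (a r) (al r - 1 / 2) (hneg r) K (blockPoints m hm x r)
  have hT := hasDerivAt_prod_of_mul (z := 0) Finset.univ
    (f := fun l ε => blockWeight (b l) (be l) (st.2 l)
      fun j => blockPoints n hn (x ∘ σ) l j + ε * blockPoints n hn (x ∘ σ) l j ^ K) fun l _ => by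
    simpa only [zero_mul, add_zero] using
      hasDerivAt_blockWeight (b l) (be l) (ht l) K (blockPoints n hn (x ∘ σ) l)
  have h := hS.mul hT
  simp only [zero_mul, add_zero] at h
  simp only [Isig_eq]
  refine h.congr_deriv ?_
  ring

end TimeDerivatives

theorem hasDerivAt_jacobian {N : ℕ} (K : ℕ) (x : Fin N → ℝ) :
    HasDerivAt
      (fun ε : ℝ => ∏ i : Fin N, (1 + ((((K : ℤ) - 1 : ℤ) : ℝ) + 1) * ε * x i ^ ((K : ℤ) - 1)))
      (K * powerSum x (K - 1)) 0 := by
  have h := hasDerivAt_prod_of_mul (z := 0) Finset.univ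
    (f := fun (i : Fin N) ε => 1 + ε * (((((K : ℤ) - 1 : ℤ) : ℝ) + 1) * x i ^ ((K : ℤ) - 1)))
    fun i _ => by
      simpa only [zero_mul, add_zero, mul_one] using
        hasDerivAt_one_add_mul (((((K : ℤ) - 1 : ℤ) : ℝ) + 1) * x i ^ ((K : ℤ) - 1))
  rw [powerSum_zpow] at h
  simp only [zero_mul, add_zero, Finset.prod_const_one, mul_one] at h
  refine h.congr_of_eventuallyEq (Filter.Eventually.of_forall fun ε => ?_)
  exact Finset.prod_congr rfl fun i _ => by ring


/-- **Lemma 4.2**: for every permutation `σ ∈ S_N` and every `k ≥ −1`, the substituted and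
Jacobian-corrected integrand satisfies
`(d/dε)|_{ε=0} [I^σ(x + εx^{k+1}; t,s) ∏_i (1+(k+1)εx_i^k)] = (𝕍_k^{m,n} I^σ)(x; t,s)`,
where `𝕍_k^{m,n}` acts on `I^σ` as a function of the time variables with `x` fixed. -/
theorem variational_formula (q p N : ℕ) (hq : 1 ≤ q) (hp : 1 ≤ p)
    (m : Fin q → ℕ) (n : Fin p → ℕ) (hm1 : ∀ r, 1 ≤ m r) (hn1 : ∀ l, 1 ≤ n l)
    (hm : ∑ r, m r = N) (hn : ∑ l, n l = N)
    (a al : Fin q → ℝ) (b be : Fin p → ℝ)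
    (σ : Equiv.Perm (Fin N)) (x : Fin N → ℝ) (st : TS q p)
    (hs : ∀ i, (Function.support (st.1 i)).Finite)
    (ht : ∀ i, (Function.support (st.2 i)).Finite)
    (k : ℤ) (hk : -1 ≤ k) :
    deriv (fun ε : ℝ =>
        Isig q p N m n hm hn a al b be σ (fun i => x i + ε * x i ^ (k + 1).toNat) st *
          ∏ i : Fin N, (1 + ((k : ℝ) + 1) * ε * x i ^ k)) 0
      = Vts a al b be m n k (fun st' => Isig q p N m n hm hn a al b be σ x st') st := by
  obtain ⟨K, rfl⟩ : ∃ K : ℕ, k = (K : ℤ) - 1 := ⟨(k + 1).toNat, by omega⟩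
  have hK : ((K : ℤ) - 1 + 1).toNat = K := by omega
  rw [hK, ((hasDerivAt_Isig hm hn a al b be σ x hs ht K).fun_mul (hasDerivAt_jacobian K x)).deriv,
    Vts_Isig hm hn a al b be σ x hs ht K]
  have hsum : powerSum x (K - 1) = ∑ r, powerSum (blockPoints m hm x r) (K - 1) :=
    (sum_blocks m hm fun i => x i ^ (K - 1)).symm
  rw [Finset.sum_add_distrib (g := fun r => K * powerSum (blockPoints m hm x r) (K - 1)),
    ← Finset.mul_sum, ← hsum]
  simp only [mul_zero, zero_mul, add_zero, Finset.prod_const_one, mul_one]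
  ring
end
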